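/- Let D = (μ, η) be a data distribution over ℝ^d × {±1} with η continuous, and let {U_x} be a collection of robustness regions such that each U_x is closed and bounded and, for every x ∈ D⁺ and every x' ∈ U_x, ρ(x, x') < ρ(D⁻ ∪ D_{1/2}, x'). Then for every x ∈ D⁺ there exist p, Δ > 0 such that x is (p, Δ)-covered. -/

import Mathlib

open MeasureTheory Metric Set Filter Topology
open scoped ENNReal Classical

noncomputable section

/-- The real value of a `Bool` label: `true ↦ +1`, `false ↦ -1`. -/
def labelVal (b : Bool) : ℝ := if b then 1 else -1

abbrev Eucl (d : ℕ) : Type := EuclideanSpace ℝ (Fin d)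

section BasicDefs

variable {E : Type*} [MeasurableSpace E]

/-- The joint distribution on instance-label pairs determined by the marginal `μ`
and the regression function `η` (label `+1` with probability `η x`). -/
def jointD (μ : Measure E) (η : E → ℝ) : Measure (E × Bool) :=
  μ.bind fun x =>
    ENNReal.ofReal (η x) • Measure.dirac (x, true) +
      ENNReal.ofReal (1 - η x) • Measure.dirac (x, false)

/-- The distribution of an i.i.d. sample of size `n` from `D = (μ, η)`. -/
def sampleD (μ : Measure E) (η : E → ℝ) (n : ℕ) : Measure (Fin n → E × Bool) :=
  Measure.pi fun _ => jointD μ η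

/-- The accuracy `A(f, D) = P_{(x,y) ∼ D}[f x = y]`. -/
def accuracy (μ : Measure E) (η : E → ℝ) (f : E → Bool) : ℝ :=
  (jointD μ η {p | f p.1 = p.2}).toReal

/-- The astuteness `A_U(f, D) = P_{(x,y) ∼ D}[f x' = y for all x' ∈ U x]`. -/
def astuteness (μ : Measure E) (η : E → ℝ) (U : E → Set E) (f : E → Bool) : ℝ :=
  (jointD μ η {p | ∀ x' ∈ U p.1, f x' = p.2}).toReal

/-- The Bayes optimal classifier: `+1` iff `η x ≥ 1/2`. -/
def bayes (η : E → ℝ) : E → Bool := fun x => if (1/2 : ℝ) ≤ η x then true else false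

end BasicDefs

section MetricDefs

variable {E : Type*} [MetricSpace E]

/-- The neighborhood preserving Bayes optimal classifier:
`+1` at `x` iff `ρ(x, μ⁺) ≤ ρ(x, μ⁻)`. -/
def gNeighbor (η : E → ℝ) : E → Bool := fun x =>
  if infDist x {z | (1/2 : ℝ) < η z} ≤ infDist x {z | η z < (1/2 : ℝ)} then true else false

/-- The neighborhood preserving robustness region `V_x`. -/
def nbhdRegion (η : E → ℝ) (x : E) : Set E :=
  if (1/2 : ℝ) < η x then {x' | dist x x' < infDist x' {z | η z ≤ (1/2 : ℝ)}}
  else if η x < (1/2 : ℝ) then {x' | dist x x' < infDist x' {z | (1/2 : ℝ) ≤ η z}}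
  else {x}

/-- The partial neighborhood preserving robustness region `V_x^κ`. -/
def nbhdRegionK (η : E → ℝ) (κ : ℝ) (x : E) : Set E :=
  if (1/2 : ℝ) < η x then {x' | dist x x' < κ * infDist x' {z | η z ≤ (1/2 : ℝ)}}
  else if η x < (1/2 : ℝ) then {x' | dist x x' < κ * infDist x' {z | (1/2 : ℝ) ≤ η z}}
  else {x}

variable [MeasurableSpace E]

/-- The support of a measure: all points whose balls all have positive mass. -/
def msupport (μ : Measure E) : Set E := {x | ∀ r > 0, 0 < μ (Metric.ball x r)}

/-- `D⁺`: points of the support where `η > 1/2`. -/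
def Dplus (μ : Measure E) (η : E → ℝ) : Set E := {x | x ∈ msupport μ ∧ (1/2 : ℝ) < η x}

/-- `D⁻`: points of the support where `η < 1/2`. -/
def Dminus (μ : Measure E) (η : E → ℝ) : Set E := {x | x ∈ msupport μ ∧ η x < (1/2 : ℝ)}

/-- `D_{1/2}`: points of the support where `η = 1/2`. -/
def Dhalf (μ : Measure E) (η : E → ℝ) : Set E := {x | x ∈ msupport μ ∧ η x = (1/2 : ℝ)}

/-- The partial neighborhood preserving robustness region `V_x^κ`, support version. -/
def nbhdRegionKSupp (μ : Measure E) (η : E → ℝ) (κ : ℝ) (x : E) : Set E :=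
  if x ∈ Dplus μ η then {x' | dist x x' < κ * infDist x' (Dminus μ η ∪ Dhalf μ η)}
  else if x ∈ Dminus μ η then {x' | dist x x' < κ * infDist x' (Dplus μ η ∪ Dhalf μ η)}
  else {x}

/-- The probability radius `r_p(x) = inf {r : μ(B(x,r)) ≥ p}`. -/
def probRadius (μ : Measure E) (p : ℝ) (x : E) : ℝ :=
  sInf {r : ℝ | ENNReal.ofReal p ≤ μ (closedBall x r)}

/-- `r_p^ε(x) = sup {r : μ(B(x,r)) − μ(B(x,r_p(x))) ≤ ε}`. -/
def probRadiusEps (μ : Measure E) (p ε : ℝ) (x : E) : ℝ :=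
  sSup {r : ℝ | (μ (closedBall x r)).toReal - (μ (closedBall x (probRadius μ p x))).toReal ≤ ε}

/-- `x` is `(p, Δ)`-covered: for all `x' ∈ U x` and all
`x'' ∈ B(x', r_p(x')) ∩ supp(μ)`, `η x'' > 1/2 + Δ`. -/
def Covered (μ : Measure E) (η : E → ℝ) (U : E → Set E) (p Δ : ℝ) (x : E) : Prop :=
  ∀ x' ∈ U x, ∀ x'' ∈ closedBall x' (probRadius μ p x') ∩ msupport μ, 1/2 + Δ < η x''

end MetricDefs

/-- A weight function: for each sample of instances it produces nonnegative
weights summing to one, depending only on the instances. -/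
structure WeightFn (E : Type*) where
  w : (n : ℕ) → (Fin n → E) → Fin n → E → ℝ
  nonneg : ∀ n xs i x, 0 ≤ w n xs i x
  le_one : ∀ n xs i x, w n xs i x ≤ 1
  sum_one : ∀ (n : ℕ) (xs : Fin n → E) (x : E), 0 < n → ∑ i, w n xs i x = 1

/-- The classifier learned by a weight function from the sample `S`:
`+1` iff `∑ i, w_i(x) y_i > 0`. -/
def WeightFn.classify {E : Type*} (W : WeightFn E) {n : ℕ} (S : Fin n → E × Bool) : E → Bool :=
  fun x => if 0 < ∑ i, W.w n (fun j => (S j).1) i x * labelVal (S i).2 then true else false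

/-- The splitting number of a family of weights on a fixed sample: the number of
distinct sets `{i : ρ(x, x_i) ≤ α, w_i(x) ≥ β}`. -/
def splitNumRaw {E : Type*} [MetricSpace E] {n : ℕ} (xs : Fin n → E) (w : Fin n → E → ℝ) : ℕ :=
  Set.ncard {T : Set (Fin n) | ∃ (x : E) (α β : ℝ), 0 ≤ α ∧ β ∈ Icc (0:ℝ) 1 ∧
    T = {i | dist x (xs i) ≤ α ∧ β ≤ w i x}}

/-- The splitting number `T(W, S)` of a weight function. -/
def WeightFn.splitNum {E : Type*} [MetricSpace E] (W : WeightFn E) {n : ℕ}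
    (xs : Fin n → E) : ℕ :=
  splitNumRaw xs (W.w n xs)

/-- Consistency with respect to accuracy: the accuracy of the learned classifier
converges in probability to the accuracy of the Bayes optimal classifier. -/
def ConsistentAcc {E : Type*} [MeasurableSpace E] (W : WeightFn E)
    (μ : Measure E) (η : E → ℝ) : Prop :=
  ∀ ε > (0:ℝ), ∀ δ > (0:ℝ), ∃ N : ℕ, ∀ n ≥ N,
    ENNReal.ofReal (1 - δ) ≤
      sampleD μ η n {S | accuracy μ η (bayes η) - ε ≤ accuracy μ η (W.classify S)}

/-- Neighborhood consistency: for all `0 < ε, δ, κ < 1`, eventually with probability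
at least `1 - δ` the astuteness w.r.t. `V^κ` is at least `A(g, D) - ε`. -/
def NbhdConsistent {E : Type*} [MetricSpace E] [MeasurableSpace E] (W : WeightFn E)
    (μ : Measure E) (η : E → ℝ) : Prop :=
  ∀ ε ∈ Ioo (0:ℝ) 1, ∀ δ ∈ Ioo (0:ℝ) 1, ∀ κ ∈ Ioo (0:ℝ) 1, ∃ N : ℕ, ∀ n ≥ N,
    ENNReal.ofReal (1 - δ) ≤
      sampleD μ η n {S | accuracy μ η (bayes η) - ε ≤
        astuteness μ η (nbhdRegionK η κ) (W.classify S)}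

/-- Condition 2 of the main theorem: vanishing expected supremal weight outside
the probability-radius balls. -/
def Cond2 {E : Type*} [MetricSpace E] [MeasurableSpace E] (W : WeightFn E)
    (μ : Measure E) (η : E → ℝ) : Prop :=
  ∀ p ∈ Ioo (0:ℝ) 1,
    Tendsto (fun n => ∫ S, (⨆ x : E, ∑ i, W.w n (fun j => (S j).1) i x *
      (if probRadius μ p x < dist x ((S i).1) then (1:ℝ) else 0)) ∂ sampleD μ η n)
      atTop (nhds 0)

/-- Condition 3 of the main theorem: `E[t_n · sup_x max_i w_i(x)] → 0`. -/
def Cond3 {E : Type*} [MetricSpace E] [MeasurableSpace E] (W : WeightFn E)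
    (μ : Measure E) (η : E → ℝ) (t : ℕ → ℕ) : Prop :=
  Tendsto (fun n => ∫ S, (t n : ℝ) *
    (⨆ x : E, ⨆ i, W.w n (fun j => (S j).1) i x) ∂ sampleD μ η n) atTop (nhds 0)

/-- Condition 4 of the main theorem: `E[log T(W,S) / t_n] → 0`. -/
def Cond4 {E : Type*} [MetricSpace E] [MeasurableSpace E] (W : WeightFn E)
    (μ : Measure E) (η : E → ℝ) (t : ℕ → ℕ) : Prop :=
  Tendsto (fun n => ∫ S, Real.log (W.splitNum (fun j => (S j).1)) / (t n : ℝ)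
    ∂ sampleD μ η n) atTop (nhds 0)

/-- `f` is a `k`-nearest neighbor classifier for the labelled sample `(xs, ys)`:
at every query point it takes a majority vote over some set of `k` nearest points. -/
def IsKNNClassifier {E : Type*} [MetricSpace E] {n : ℕ} (k : ℕ)
    (xs : Fin n → E) (ys : Fin n → Bool) (f : E → Bool) : Prop :=
  ∀ x : E, ∃ T : Finset (Fin n), T.card = min k n ∧
    (∀ i ∈ T, ∀ j ∉ T, dist x (xs i) ≤ dist x (xs j)) ∧
    (f x = true ↔ 0 < ∑ i ∈ T, labelVal (ys i))

/-- `W` is the weight function of the `k_n`-nearest neighbor classifier. -/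
def IsKNNWeightSeq {E : Type*} [MetricSpace E] (k : ℕ → ℕ) (W : WeightFn E) : Prop :=
  ∀ (n : ℕ) (xs : Fin n → E) (x : E), ∃ T : Finset (Fin n), T.card = min (k n) n ∧
    (∀ i ∈ T, ∀ j ∉ T, dist x (xs i) ≤ dist x (xs j)) ∧
    ∀ i, W.w n xs i x = if i ∈ T then ((min (k n) n : ℝ))⁻¹ else 0

/-- `w` is the weight family of the `k`-nearest neighbor rule on the sample `xs`
with ties in distance broken by smaller value of `z`. -/
def IsKNNTieWeight {E : Type*} [MetricSpace E] {n : ℕ} (k : ℕ) (xs : Fin n → E)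
    (z : Fin n → ℝ) (w : Fin n → E → ℝ) : Prop :=
  ∀ x : E, ∃ T : Finset (Fin n), T.card = min k n ∧
    (∀ i ∈ T, ∀ j ∉ T,
      dist x (xs i) < dist x (xs j) ∨ (dist x (xs i) = dist x (xs j) ∧ z i ≤ z j)) ∧
    ∀ i, w i x = if i ∈ T then ((min k n : ℝ))⁻¹ else 0

/-- The kernel weights `w_i(x) = K(ρ(x,x_i)/h) / ∑_j K(ρ(x,x_j)/h)`. -/
def kernelW (K : ℝ → ℝ) (h : ℝ) {E : Type*} [MetricSpace E] {n : ℕ}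
    (xs : Fin n → E) (i : Fin n) (x : E) : ℝ :=
  K (dist x (xs i) / h) / ∑ j, K (dist x (xs j) / h)

/-- The kernel classifier: `+1` iff `∑_i K(ρ(x,x_i)/h) y_i > 0`. -/
def kernelClassify (K : ℝ → ℝ) (h : ℝ) {E : Type*} [MetricSpace E] {n : ℕ}
    (S : Fin n → E × Bool) : E → Bool :=
  fun x => if 0 < ∑ i, K (dist x ((S i).1) / h) * labelVal (S i).2 then true else false

end

section Helpers

open MeasureTheory Metric Set

variable {E : Type*} [MetricSpace E] [MeasurableSpace E]

theorem isClosed_msupport (μ : Measure E) : IsClosed (msupport μ) := by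
  refine isClosed_of_closure_subset fun y hy r hr => ?_
  obtain ⟨z, hz, hyz⟩ := Metric.mem_closure_iff.1 hy (r / 2) (half_pos hr)
  refine (hz (r / 2) (half_pos hr)).trans_le (measure_mono (ball_subset_ball' ?_))
  rw [dist_comm] at hyz
  linarith

theorem probRadius_le {μ : Measure E} {p r : ℝ} {x : E} (hp : 0 < p)
    (h : ENNReal.ofReal p ≤ μ (closedBall x r)) : probRadius μ p x ≤ r := by
  refine csInf_le ⟨0, fun s (hs : ENNReal.ofReal p ≤ μ (closedBall x s)) => ?_⟩ h
  by_contra! hneg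
  rw [closedBall_eq_empty.2 hneg, measure_empty, nonpos_iff_eq_zero,
    ENNReal.ofReal_eq_zero] at hs
  exact hp.not_ge hs

/-- At a support point, the probability radius of every `x'` exceeds `dist x x'` by at most `ε`,
once `p` is small enough. -/
theorem exists_probRadius_le_dist_add {μ : Measure E} {x : E} (hx : x ∈ msupport μ) {ε : ℝ}
    (hε : 0 < ε) : ∃ p > (0 : ℝ), ∀ x', probRadius μ p x' ≤ dist x x' + ε := by
  obtain ⟨p, hp, hpμ⟩ := ENNReal.lt_iff_exists_nnreal_btwn.1 (hx ε hε)
  have hp0 : (0 : ℝ) < p := by exact_mod_cast hp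
  refine ⟨p, hp0, fun x' => probRadius_le hp0 ?_⟩
  rw [ENNReal.ofReal_coe_nnreal]
  refine hpμ.le.trans
    (measure_mono (ball_subset_closedBall.trans (closedBall_subset_closedBall' ?_)))
  linarith

/-- A continuous function that is positive on a compact set is bounded below there by a positive
constant, strictly. -/
theorem IsCompact.exists_pos_forall_lt {X : Type*} [TopologicalSpace X] {K : Set X}
    (hK : IsCompact K) {f : X → ℝ} (hf : Continuous f) (hpos : ∀ x ∈ K, 0 < f x) :
    ∃ ε > (0 : ℝ), ∀ x ∈ K, ε < f x := by
  obtain ⟨a, ha, h⟩ := hK.exists_forall_le' hf.continuousOn hpos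
  exact ⟨a / 2, half_pos ha, fun x hx => (half_lt_self ha).trans_le (h x hx)⟩

theorem exists_covered [ProperSpace E] {μ : Measure E} {η : E → ℝ} (hη : Continuous η)
    {U : E → Set E} {x : E} (hU : IsCompact (U x)) (hx : x ∈ msupport μ)
    (hsep : ∀ x' ∈ U x, dist x x' < infDist x' (Dminus μ η ∪ Dhalf μ η)) :
    ∃ p > (0 : ℝ), ∃ Δ > (0 : ℝ), Covered μ η U p Δ x := by
  obtain ⟨ε, hε, hgap⟩ := hU.exists_pos_forall_lt
    (f := fun x' => infDist x' (Dminus μ η ∪ Dhalf μ η) - dist x x')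
    ((continuous_infDist_pt _).sub (continuous_const.dist continuous_id))
    fun x' hx' => sub_pos.2 (hsep x' hx')
  obtain ⟨p, hp, hrad⟩ := exists_probRadius_le_dist_add hx hε
  obtain ⟨R, hR⟩ := hU.isBounded.subset_closedBall x
  have hcompact : IsCompact ((U x ×ˢ closedBall x (R + R + ε)) ∩
      ({q : E × E | dist q.2 q.1 ≤ dist x q.1 + ε} ∩ Prod.snd ⁻¹' msupport μ)) :=
    (hU.prod (isCompact_closedBall _ _)).inter_right
      ((isClosed_le (by fun_prop) (by fun_prop)).inter
        ((isClosed_msupport μ).preimage continuous_snd))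
  obtain ⟨Δ, hΔ, hmargin⟩ := hcompact.exists_pos_forall_lt (f := fun q => η q.2 - 1 / 2)
    (by fun_prop) (by
      rintro ⟨x', y⟩ ⟨⟨hx', -⟩, hdist, hy⟩
      by_contra! hle
      have hmem : y ∈ Dminus μ η ∪ Dhalf μ η := by
        rcases (sub_nonpos.1 hle).lt_or_eq with h | h
        · exact Or.inl ⟨hy, h⟩
        · exact Or.inr ⟨hy, h⟩
      have hinf := infDist_le_dist_of_mem (x := x') hmem
      have hlt := hgap x' hx'
      simp only [mem_ofPred_eq] at hdist hlt
      rw [dist_comm] at hdist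
      linarith)
  refine ⟨p, hp, Δ, hΔ, fun x' hx' y ⟨hyball, hy⟩ => ?_⟩
  have hdist : dist y x' ≤ dist x x' + ε := (mem_closedBall.1 hyball).trans (hrad x')
  have hxR : dist x' x ≤ R := hR hx'
  have hyR : dist y x ≤ R + R + ε := by
    have htri := dist_triangle y x' x
    rw [dist_comm x x'] at hdist
    linarith
  have hlt := hmargin (x', y) ⟨⟨hx', hyR⟩, hdist, hy⟩
  simp only at hlt
  linarith

end Helpers

section Statements

open MeasureTheory Metric Set Filter Topology
open scoped ENNReal Classical

/-- every point of `D⁺` is `(p, Δ)`-covered for some `p, Δ > 0`. -/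
theorem stmt9 {d : ℕ} (μ : Measure (Eucl d)) (η : Eucl d → ℝ) (hηc : Continuous η)
    (U : Eucl d → Set (Eucl d)) (hUc : ∀ x, IsClosed (U x))
    (hUb : ∀ x, Bornology.IsBounded (U x))
    (hsep : ∀ x ∈ Dplus μ η, ∀ x' ∈ U x,
      dist x x' < infDist x' (Dminus μ η ∪ Dhalf μ η)) :
    ∀ x ∈ Dplus μ η, ∃ p > (0:ℝ), ∃ Δ > (0:ℝ), Covered μ η U p Δ x := by
  intro x hx
  exact exists_covered hηc (isCompact_of_isClosed_isBounded (hUc x) (hUb x)) hx.1 (hsep x hx)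

end Statements
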